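/- A_{k+1}(S) depends only on the multiset of cyclic gaps of S: if S = {a_1 < ... < a_m} ⊆ {0,...,n−1} and T = {b_1 < ... < b_m} ⊆ {0,...,n−1} have equal multisets of cyclic consecutive differences {a_2−a_1, ..., a_m−a_{m−1}, a_1+n−a_m} = {b_2−b_1, ..., b_m−b_{m−1}, b_1+n−b_m}, then A_{k+1}(S) = A_{k+1}(T). -/

import Mathlib

/-- Two blocks `B`, `B'` form a crossing: there are `i, k ∈ B` and `j, l ∈ B'`
with `i < j < k < l` or `i > j > k > l`. -/
def Crosses (B B' : Finset ℕ) : Prop :=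
  ∃ i ∈ B, ∃ k ∈ B, ∃ j ∈ B', ∃ l ∈ B',
    (i < j ∧ j < k ∧ k < l) ∨ (i > j ∧ j > k ∧ k > l)

/-- `ρ` is a set partition of `{0, ..., n-1}`. -/
def IsPartitionOf (n : ℕ) (ρ : Finset (Finset ℕ)) : Prop :=
  (∀ B ∈ ρ, B.Nonempty) ∧
  (∀ B ∈ ρ, ∀ B' ∈ ρ, B ≠ B' → Disjoint B B') ∧
  ρ.sup id = Finset.range n

/-- `r` is an orientation of the crossing graph `G(ρ)`: it relates exactly the
pairs of distinct crossing blocks of `ρ`, choosing one direction for each edge. -/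
def IsOrientation (ρ : Finset (Finset ℕ)) (r : Finset ℕ → Finset ℕ → Prop) : Prop :=
  (∀ B B', r B B' → B ∈ ρ ∧ B' ∈ ρ ∧ B ≠ B' ∧ Crosses B B') ∧
  (∀ B ∈ ρ, ∀ B' ∈ ρ, B ≠ B' → Crosses B B' → (r B B' ↔ ¬ r B' B))

/-- An orientation is acyclic if it has no directed cycle. -/
def AcyclicRel (r : Finset ℕ → Finset ℕ → Prop) : Prop :=
  ∀ B, ¬ Relation.TransGen r B B

/-- `r` is a root-connected orientation of `G(ρ)` with root `S`: it is an acyclic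
orientation and `S` is its unique source. -/
def RootConnected (ρ : Finset (Finset ℕ)) (r : Finset ℕ → Finset ℕ → Prop)
    (S : Finset ℕ) : Prop :=
  IsOrientation ρ r ∧ AcyclicRel r ∧ S ∈ ρ ∧ (∀ B', ¬ r B' S) ∧
    (∀ B ∈ ρ, (∀ B', ¬ r B' B) → B = S)

/-- `ρ ∈ M_S(n)`: a partition of `{0,...,n-1}` with `S` as a block and all
other blocks of size 2. -/
def MSPartition (n : ℕ) (S : Finset ℕ) (ρ : Finset (Finset ℕ)) : Prop :=
  IsPartitionOf n ρ ∧ S ∈ ρ ∧ ∀ B ∈ ρ, B ≠ S → B.card = 2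

/-- The number of pairs `(ρ, r)` with `ρ ∈ M_S(n)` and `r` a root-connected
orientation of `G(ρ)` with root `S`.  (This is `A_{k+1}(S)` when `n = |S| + 2k`.) -/
noncomputable def countA (n : ℕ) (S : Finset ℕ) : ℕ :=
  Nat.card {p : Finset (Finset ℕ) × (Finset ℕ → Finset ℕ → Prop) //
    MSPartition n S p.1 ∧ RootConnected p.1 p.2 S}

/-- The multiset of cyclic gaps of `S ⊆ {0,...,n-1}`: the differences of
cyclically consecutive elements of `S`, taken mod `n`. -/
def cyclicGaps (n : ℕ) (S : Finset ℕ) : Multiset ℤ :=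
  ↑(List.zipWith (fun x y : ℕ => (((y : ℤ) - (x : ℤ)) % (n : ℤ)))
      (S.sort (· ≤ ·)) ((S.sort (· ≤ ·)).rotate 1))

theorem Crosses.symm {B B' : Finset ℕ} (h : Crosses B B') : Crosses B' B := by
  obtain ⟨i, hi, k, hk, j, hj, l, hl, h | h⟩ := h
  · exact ⟨l, hl, j, hj, k, hk, i, hi, Or.inr ⟨h.2.2, h.2.1, h.1⟩⟩
  · exact ⟨l, hl, j, hj, k, hk, i, hi, Or.inl ⟨h.2.2, h.2.1, h.1⟩⟩

/-- `μ` is a perfect matching of `V`, viewed as a set of two-element blocks. -/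
def IsMatchingOf (V : Finset ℕ) (μ : Finset (Finset ℕ)) : Prop :=
  (∀ B ∈ μ, B.card = 2) ∧ (∀ B ∈ μ, ∀ B' ∈ μ, B ≠ B' → Disjoint B B') ∧ μ.sup id = V

/-- The number of perfect matchings of `V` together with an acyclic orientation of the
crossing graph. -/
noncomputable def acyclicMatchingCount (V : Finset ℕ) : ℕ :=
  Nat.card {p : Finset (Finset ℕ) × (Finset ℕ → Finset ℕ → Prop) //
    IsMatchingOf V p.1 ∧ IsOrientation p.1 p.2 ∧ AcyclicRel p.2}

theorem finite_setOf_isOrientation (n : ℕ) :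
    {p : Finset (Finset ℕ) × (Finset ℕ → Finset ℕ → Prop) |
      p.1.sup id = Finset.range n ∧ IsOrientation p.1 p.2}.Finite := by
  let Q := (Finset.range n).powerset
  let f : Finset (Finset ℕ) × (Finset ℕ → Finset ℕ → Prop) → (Q → Prop) × (Q → Q → Prop) :=
    fun p => (fun x => x.1 ∈ p.1, fun x y => p.2 x y)
  have hQ : ∀ ρ : Finset (Finset ℕ), ρ.sup id = Finset.range n → ∀ B ∈ ρ, B ∈ Q := by
    intro ρ h B hB
    rw [Finset.mem_powerset, ← h]
    exact Finset.le_sup (f := id) hB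
  refine Set.Finite.of_finite_image (f := f) (Set.toFinite _) ?_
  rintro ⟨ρ, r⟩ ⟨hρ, hr⟩ ⟨ρ', r'⟩ ⟨hρ', hr'⟩ h
  simp only [f, Prod.mk.injEq] at h hρ hρ' hr hr' ⊢
  constructor
  · ext B
    exact ⟨fun hB => (congrFun h.1 ⟨B, hQ _ hρ B hB⟩).mp hB,
      fun hB => (congrFun h.1 ⟨B, hQ _ hρ' B hB⟩).mpr hB⟩
  · ext B B'
    constructor
    · intro hB
      have := hr.1 _ _ hB
      exact (congrFun (congrFun h.2 ⟨B, hQ _ hρ B this.1⟩) ⟨B', hQ _ hρ B' this.2.1⟩).mp hB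
    · intro hB
      have := hr'.1 _ _ hB
      exact (congrFun (congrFun h.2 ⟨B, hQ _ hρ' B this.1⟩) ⟨B', hQ _ hρ' B' this.2.1⟩).mpr hB

theorem card_orientations_with_sources (n : ℕ) (S : Finset ℕ) (J : Finset (Finset ℕ))
    (hSJ : S ∈ J) (hne : ∀ B ∈ J, B.Nonempty) (htwo : ∀ B ∈ J, B ≠ S → B.card = 2)
    (hdisj : ∀ B ∈ J, ∀ B' ∈ J, B ≠ B' → Disjoint B B')
    (hcr : ∀ B ∈ J, ∀ B' ∈ J, B ≠ B' → ¬ Crosses B B') (hsub : J.sup id ⊆ Finset.range n) :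
    Nat.card {p : Finset (Finset ℕ) × (Finset ℕ → Finset ℕ → Prop) //
      MSPartition n S p.1 ∧ IsOrientation p.1 p.2 ∧ AcyclicRel p.2 ∧
        ∀ B ∈ J, B ∈ p.1 ∧ ∀ B', ¬ p.2 B' B} =
    acyclicMatchingCount (Finset.range n \ J.sup id) := by
  classical
  have hnotJ : ∀ μ, IsMatchingOf (Finset.range n \ J.sup id) μ → ∀ B ∈ μ, B ∉ J := by
    rintro μ ⟨h2, -, hs⟩ B hB hBJ
    obtain ⟨x, hx⟩ := hne B hBJ
    have h1 : x ∈ μ.sup id := Finset.mem_sup.2 ⟨B, hB, hx⟩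
    rw [hs, Finset.mem_sdiff] at h1
    exact h1.2 (Finset.mem_sup.2 ⟨B, hBJ, hx⟩)
  have hdJ : ∀ μ, IsMatchingOf (Finset.range n \ J.sup id) μ → ∀ B ∈ μ, ∀ B' ∈ J,
      Disjoint B B' := by
    rintro μ ⟨h2, -, hs⟩ B hB B' hBJ
    rw [Finset.disjoint_left]
    intro x hx hx'
    have h1 : x ∈ μ.sup id := Finset.mem_sup.2 ⟨B, hB, hx⟩
    rw [hs, Finset.mem_sdiff] at h1
    exact h1.2 (Finset.mem_sup.2 ⟨B', hBJ, hx'⟩)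
  refine Nat.card_congr
    { toFun := fun p => ⟨(p.1.1 \ J, fun B B' => p.1.2 B B' ∧ B ∉ J), ?_⟩
      invFun := fun q => ⟨(q.1.1 ∪ J, fun B B' => q.1.2 B B' ∨
        (B ∈ J ∧ B' ∈ q.1.1 ∧ Crosses B B')), ?_⟩
      left_inv := ?_
      right_inv := ?_ }
  · obtain ⟨⟨ρ, r⟩, ⟨⟨-, hd, hs⟩, hSρ, h2⟩, ho, ha, hJ⟩ := p
    dsimp only at *
    refine ⟨⟨?_, ?_, ?_⟩, ⟨?_, ?_⟩, ?_⟩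
    · intro B hB
      rw [Finset.mem_sdiff] at hB
      exact h2 B hB.1 (fun h => hB.2 (h ▸ hSJ))
    · intro B hB B' hB'
      exact hd B (Finset.mem_sdiff.1 hB).1 B' (Finset.mem_sdiff.1 hB').1
    · ext x
      simp only [Finset.mem_sup, Finset.mem_sdiff, id, ← hs]
      constructor
      · rintro ⟨B, ⟨hB, hBJ⟩, hx⟩
        refine ⟨⟨B, hB, hx⟩, ?_⟩
        rintro ⟨B', hB', hx'⟩
        exact Finset.disjoint_left.1 (hd B hB B' (hJ B' hB').1 (fun h => hBJ (h ▸ hB'))) hx hx'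
      · rintro ⟨⟨B, hB, hx⟩, h⟩
        exact ⟨B, ⟨hB, fun hBJ => h ⟨B, hBJ, hx⟩⟩, hx⟩
    · rintro B B' ⟨hr, hB⟩
      have := ho.1 _ _ hr
      exact ⟨Finset.mem_sdiff.2 ⟨this.1, hB⟩,
        Finset.mem_sdiff.2 ⟨this.2.1, fun h => (hJ B' h).2 B hr⟩, this.2.2⟩
    · intro B hB B' hB' hne hc
      rw [Finset.mem_sdiff] at hB hB'
      simp only [hB.2, hB'.2, not_false_eq_true, and_true]
      exact ho.2 B hB.1 B' hB'.1 hne hc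
    · intro B hB
      exact ha B (Relation.TransGen.lift id (fun _ _ h => h.1) B B hB)
  · obtain ⟨⟨μ, r⟩, hm, ho, ha⟩ := q
    have hnJ := hnotJ μ hm
    have hd' := hdJ μ hm
    obtain ⟨h2, hd, hs⟩ := hm
    dsimp only at *
    refine ⟨⟨⟨?_, ?_, ?_⟩, ?_, ?_⟩, ⟨?_, ?_⟩, ?_, ?_⟩
    · intro B hB
      rcases Finset.mem_union.1 hB with h | h
      · exact Finset.card_pos.1 (by rw [h2 B h]; norm_num)
      · exact hne B h
    · intro B hB B' hB' hn
      rcases Finset.mem_union.1 hB with h | h <;> rcases Finset.mem_union.1 hB' with h' | h'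
      · exact hd B h B' h' hn
      · exact hd' B h B' h'
      · exact (hd' B' h' B h).symm
      · exact hdisj B h B' h' hn
    · rw [Finset.sup_union, hs]
      exact Finset.sdiff_union_of_subset hsub
    · exact Finset.mem_union_right _ hSJ
    · intro B hB hn
      rcases Finset.mem_union.1 hB with h | h
      · exact h2 B h
      · exact htwo B h hn
    · rintro B B' (h | ⟨h, h', hc⟩)
      · have := ho.1 _ _ h
        exact ⟨Finset.mem_union_left _ this.1, Finset.mem_union_left _ this.2.1, this.2.2⟩
      · exact ⟨Finset.mem_union_right _ h, Finset.mem_union_left _ h',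
          fun e => hnJ B' h' (e ▸ h), hc⟩
    · intro B hB B' hB' hn hc
      rcases Finset.mem_union.1 hB with h | h <;> rcases Finset.mem_union.1 hB' with h' | h'
      · simpa [hnJ B h, hnJ B' h'] using ho.2 B h B' h' hn hc
      · have h1 : ¬ r B B' := fun hr => hnJ B' (ho.1 _ _ hr).2.1 h'
        simp [h1, h, h', hc.symm, hnJ B h]
      · have h1 : ¬ r B' B := fun hr => hnJ B (ho.1 _ _ hr).2.1 h
        simp [h1, h, h', hc, hnJ B' h']
      · exact absurd hc (hcr B h B' h' hn)
    · have key : ∀ B C, Relation.TransGen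
          (fun B B' => r B B' ∨ (B ∈ J ∧ B' ∈ μ ∧ Crosses B B')) B C →
          C ∈ μ ∧ (B ∈ μ → Relation.TransGen r B C) := by
        intro B C h
        induction h with
        | single h =>
          rcases h with h | h
          · exact ⟨(ho.1 _ _ h).2.1, fun _ => .single h⟩
          · exact ⟨h.2.1, fun hB => absurd h.1 (hnJ _ hB)⟩
        | tail _ h ih =>
          rcases h with h | h
          · exact ⟨(ho.1 _ _ h).2.1, fun hB => (ih.2 hB).tail h⟩
          · exact absurd h.1 (hnJ _ ih.1)
      intro B hB
      have := key B B hB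
      exact ha B (this.2 this.1)
    · intro B hB
      refine ⟨Finset.mem_union_right _ hB, ?_⟩
      rintro B' (h | h)
      · exact hnJ B (ho.1 _ _ h).2.1 hB
      · exact hnJ B h.2.1 hB
  · rintro ⟨⟨ρ, r⟩, ⟨⟨-, hd, hs⟩, hSρ, h2⟩, ho, ha, hJ⟩
    dsimp only at *
    apply Subtype.ext
    apply Prod.ext
    · exact Finset.sdiff_union_of_subset fun B hB => (hJ B hB).1
    · funext B B'
      apply propext
      dsimp only
      constructor
      · rintro (h | ⟨h, h', hc⟩)
        · exact h.1
        · rw [Finset.mem_sdiff] at h'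
          exact (ho.2 B (hJ B h).1 B' h'.1 (fun e => h'.2 (e ▸ h)) hc).2 ((hJ B h).2 B')
      · intro h
        by_cases hB : B ∈ J
        · have := ho.1 _ _ h
          exact Or.inr ⟨hB, Finset.mem_sdiff.2 ⟨this.2.1, fun h' => (hJ B' h').2 B h⟩, this.2.2.2⟩
        · exact Or.inl ⟨h, hB⟩
  · rintro ⟨⟨μ, r⟩, hm, ho, ha⟩
    have hnJ := hnotJ μ hm
    dsimp only at *
    apply Subtype.ext
    apply Prod.ext
    · exact Finset.union_sdiff_cancel_right (Finset.disjoint_left.2 hnJ)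
    · funext B B'
      apply propext
      dsimp only
      constructor
      · rintro ⟨h | h, hB⟩
        · exact h
        · exact absurd h.1 hB
      · intro h
        exact ⟨Or.inl h, hnJ B (ho.1 _ _ h).1⟩

/-- `I` is a family of pairwise disjoint blocks, no two of which cross and none of which
crosses `S`. -/
def IsNoncrossingAlong (S : Finset ℕ) (I : Finset (Finset ℕ)) : Prop :=
  (∀ B ∈ I, ∀ B' ∈ I, B ≠ B' → Disjoint B B' ∧ ¬ Crosses B B') ∧ ∀ B ∈ I, ¬ Crosses B S

open Classical in
theorem countA_eq_sum (n : ℕ) (S : Finset ℕ) (hS : S ⊆ Finset.range n) (hne : S.Nonempty) :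
    (countA n S : ℤ) =
      ∑ I ∈ ((Finset.range n \ S).powersetCard 2).powerset with IsNoncrossingAlong S I,
        (-1 : ℤ) ^ I.card * acyclicMatchingCount ((Finset.range n \ S) \ I.sup id) := by
  let X' : Set (Finset (Finset ℕ) × (Finset ℕ → Finset ℕ → Prop)) :=
    {p | MSPartition n S p.1 ∧ IsOrientation p.1 p.2 ∧ AcyclicRel p.2 ∧ ∀ B', ¬ p.2 B' S}
  have hX' : X'.Finite := (finite_setOf_isOrientation n).subset
    fun p hp => ⟨hp.1.1.2.2, hp.2.1⟩
  let X := hX'.toFinset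
  have hX : ∀ p, p ∈ X ↔ MSPartition n S p.1 ∧ IsOrientation p.1 p.2 ∧ AcyclicRel p.2 ∧
      ∀ B', ¬ p.2 B' S := fun p => hX'.mem_toFinset
  let src : Finset (Finset ℕ) × (Finset ℕ → Finset ℕ → Prop) → Finset (Finset ℕ) :=
    fun p => p.1.filter fun B => B ≠ S ∧ ∀ B', ¬ p.2 B' B
  have hsrc : ∀ p B, B ∈ src p ↔ B ∈ p.1 ∧ B ≠ S ∧ ∀ B', ¬ p.2 B' B :=
    fun p B => Finset.mem_filter
  have hcount : countA n S = (X.filter fun p => src p = ∅).card := by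
    refine Nat.subtype_card _ fun p => ?_
    rw [Finset.mem_filter, hX, Finset.eq_empty_iff_forall_notMem]
    constructor
    · rintro ⟨⟨hM, ho, ha, hs⟩, he⟩
      refine ⟨hM, ho, ha, hM.2.1, hs, fun B hB hB' => ?_⟩
      by_contra hn
      exact he B ((hsrc _ _).2 ⟨hB, hn, hB'⟩)
    · rintro ⟨hM, ho, ha, -, hs, hu⟩
      refine ⟨⟨hM, ho, ha, hs⟩, fun B hB => ?_⟩
      have := (hsrc _ _).1 hB
      exact this.2.1 (hu B this.1 this.2.2)
  have hpair : ∀ p ∈ X, src p ⊆ (Finset.range n \ S).powersetCard 2 := by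
    intro p hp B hB
    rw [hX] at hp
    rw [hsrc] at hB
    obtain ⟨⟨⟨-, hd, hs⟩, hSρ, h2⟩, -⟩ := hp
    rw [Finset.mem_powersetCard]
    refine ⟨fun x hx => Finset.mem_sdiff.2 ⟨?_, ?_⟩, h2 B hB.1 hB.2.1⟩
    · rw [← hs]
      exact Finset.mem_sup.2 ⟨B, hB.1, hx⟩
    · exact Finset.disjoint_left.1 (hd B hB.1 S hSρ hB.2.1) hx
  have hcard : ∀ I ∈ ((Finset.range n \ S).powersetCard 2).powerset,
      (X.filter fun p => I ⊆ src p).card =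
        if IsNoncrossingAlong S I then
          acyclicMatchingCount ((Finset.range n \ S) \ I.sup id) else 0 := by
    intro I hI
    have hI' : ∀ B ∈ I, B ⊆ Finset.range n \ S ∧ B.card = 2 := fun B hB =>
      Finset.mem_powersetCard.1 (Finset.mem_powerset.1 hI hB)
    split_ifs with hv
    · have hBS : ∀ B ∈ I, Disjoint B S := fun B hB =>
        Finset.disjoint_of_subset_left (hI' B hB).1 Finset.sdiff_disjoint
      have hnS : ∀ B ∈ I, B ≠ S := by
        rintro B hB rfl
        exact hne.ne_empty (Finset.disjoint_self_iff_empty _ |>.1 (hBS _ hB))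
      have := card_orientations_with_sources n S (insert S I) (Finset.mem_insert_self _ _)
        ?_ ?_ ?_ ?_ ?_
      · rw [Finset.sup_insert, id, ← sdiff_sdiff_left] at this
        rw [← this]
        symm
        refine Nat.subtype_card _ fun p => ?_
        rw [Finset.mem_filter, hX, Finset.forall_mem_insert]
        constructor
        · rintro ⟨⟨hM, ho, ha, hs⟩, hsub⟩
          refine ⟨hM, ho, ha, ⟨hM.2.1, hs⟩, fun B hB => ?_⟩
          have := (hsrc _ _).1 (hsub hB)
          exact ⟨this.1, this.2.2⟩
        · rintro ⟨hM, ho, ha, hs, hI⟩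
          exact ⟨⟨hM, ho, ha, hs.2⟩, fun B hB =>
            (hsrc _ _).2 ⟨(hI B hB).1, hnS B hB, (hI B hB).2⟩⟩
      · intro B hB
        rcases Finset.mem_insert.1 hB with rfl | h
        · exact hne
        · exact Finset.card_pos.1 (by rw [(hI' B h).2]; norm_num)
      · intro B hB hn
        exact (hI' B ((Finset.mem_insert.1 hB).resolve_left hn)).2
      · intro B hB B' hB' hn
        rcases Finset.mem_insert.1 hB with rfl | h <;>
          rcases Finset.mem_insert.1 hB' with rfl | h'
        · exact absurd rfl hn
        · exact (hBS B' h').symm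
        · exact hBS B h
        · exact (hv.1 B h B' h' hn).1
      · intro B hB B' hB' hn
        rcases Finset.mem_insert.1 hB with rfl | h <;>
          rcases Finset.mem_insert.1 hB' with rfl | h'
        · exact absurd rfl hn
        · exact fun hc => hv.2 B' h' hc.symm
        · exact hv.2 B h
        · exact (hv.1 B h B' h' hn).2
      · rw [Finset.sup_insert]
        refine Finset.union_subset hS (Finset.sup_le fun B hB => ?_)
        exact (hI' B hB).1.trans Finset.sdiff_subset
    · rw [Finset.card_eq_zero, Finset.filter_eq_empty_iff]
      intro p hp hsub
      apply hv
      rw [hX] at hp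
      obtain ⟨⟨⟨-, hd, hs⟩, hSρ, h2⟩, ho, -, hSs⟩ := hp
      constructor
      · intro B hB B' hB' hn
        have h1 := (hsrc _ _).1 (hsub hB)
        have h2 := (hsrc _ _).1 (hsub hB')
        exact ⟨hd B h1.1 B' h2.1 hn, fun hc =>
          h2.2.2 B ((ho.2 B h1.1 B' h2.1 hn hc).2 (h1.2.2 B'))⟩
      · intro B hB hc
        have h1 := (hsrc _ _).1 (hsub hB)
        exact hSs B ((ho.2 B h1.1 S hSρ h1.2.1 hc).2 (h1.2.2 S))
  calc (countA n S : ℤ)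
      = ∑ p ∈ X, ∑ I ∈ (src p).powerset, (-1 : ℤ) ^ I.card := by
        rw [hcount, Finset.card_filter, Nat.cast_sum]
        refine Finset.sum_congr rfl fun p _ => ?_
        rw [Finset.sum_powerset_neg_one_pow_card]
        simp
    _ = ∑ p ∈ X, ∑ I ∈ ((Finset.range n \ S).powersetCard 2).powerset,
          if I ⊆ src p then (-1 : ℤ) ^ I.card else 0 := by
        refine Finset.sum_congr rfl fun p hp => ?_
        rw [← Finset.sum_filter]
        refine Finset.sum_congr ?_ fun _ _ => rfl
        ext I
        simp only [Finset.mem_powerset, Finset.mem_filter]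
        exact ⟨fun h => ⟨h.trans (hpair p hp), h⟩, fun h => h.2⟩
    _ = _ := by
        rw [Finset.sum_comm, Finset.sum_filter]
        refine Finset.sum_congr rfl fun I hI => ?_
        rw [← Finset.sum_filter, Finset.sum_const, hcard I hI]
        split_ifs <;> simp [mul_comm]

theorem AcyclicRel.comp {r : Finset ℕ → Finset ℕ → Prop} (h : AcyclicRel r)
    (f : Finset ℕ → Finset ℕ) : AcyclicRel fun B B' => r (f B) (f B') :=
  fun B hB => h (f B) (Relation.TransGen.lift f (fun _ _ h => h) B B hB)

theorem isMatchingOf_map (e : Equiv.Perm ℕ) {V : Finset ℕ} {μ : Finset (Finset ℕ)}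
    (h : IsMatchingOf V μ) :
    IsMatchingOf (e.finsetCongr V) (e.finsetCongr.finsetCongr μ) := by
  obtain ⟨h2, hd, hs⟩ := h
  refine ⟨?_, ?_, ?_⟩
  · simp only [Equiv.finsetCongr_apply, Finset.mem_map, Equiv.coe_toEmbedding]
    rintro _ ⟨B, hB, rfl⟩
    simpa using h2 B hB
  · simp only [Equiv.finsetCongr_apply, Finset.mem_map, Equiv.coe_toEmbedding]
    rintro _ ⟨B, hB, rfl⟩ _ ⟨B', hB', rfl⟩ hn
    simp only [Finset.disjoint_map]
    exact hd B hB B' hB' (fun h => hn (h ▸ rfl))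
  · subst hs
    ext x
    simp [Finset.mem_sup]

theorem isOrientation_comp (e : Equiv.Perm (Finset ℕ)) {μ : Finset (Finset ℕ)}
    {r : Finset ℕ → Finset ℕ → Prop}
    (hc : ∀ B ∈ μ, ∀ B' ∈ μ, (Crosses (e B) (e B') ↔ Crosses B B')) (h : IsOrientation μ r) :
    IsOrientation (e.finsetCongr μ) fun B B' => r (e.symm B) (e.symm B') := by
  obtain ⟨h1, h2⟩ := h
  constructor
  · intro B B' hr
    obtain ⟨hB, hB', hn, hx⟩ := h1 _ _ hr
    refine ⟨?_, ?_, fun h => hn (h ▸ rfl), ?_⟩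
    · exact Finset.mem_map.2 ⟨_, hB, by simp⟩
    · exact Finset.mem_map.2 ⟨_, hB', by simp⟩
    · simpa using (hc _ hB _ hB').2 hx
  · simp only [Equiv.finsetCongr_apply, Finset.mem_map, Equiv.coe_toEmbedding]
    rintro _ ⟨B, hB, rfl⟩ _ ⟨B', hB', rfl⟩ hn hx
    simpa using h2 B hB B' hB' (fun h => hn (h ▸ rfl)) ((hc B hB B' hB').1 hx)

theorem acyclicMatchingCount_congr (e : Equiv.Perm ℕ) (V : Finset ℕ)
    (hc : ∀ B ⊆ V, ∀ B' ⊆ V,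
      (Crosses (e.finsetCongr B) (e.finsetCongr B') ↔ Crosses B B')) :
    acyclicMatchingCount V = acyclicMatchingCount (e.finsetCongr V) := by
  have hsub : ∀ {V μ}, IsMatchingOf V μ → ∀ B ∈ μ, B ⊆ V := fun h B hB => by
    rw [← h.2.2]
    exact Finset.le_sup (f := id) hB
  let E := e.finsetCongr
  refine Nat.card_congr (Equiv.subtypeEquiv
    (E.finsetCongr.prodCongr (E.arrowCongr (E.arrowCongr (Equiv.refl Prop)))) ?_)
  rintro ⟨μ, r⟩
  constructor
  · rintro ⟨hm, ho, ha⟩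
    exact ⟨isMatchingOf_map e hm, isOrientation_comp E
      (fun B hB B' hB' => hc B (hsub hm B hB) B' (hsub hm B' hB')) ho, ha.comp E.symm⟩
  · rintro ⟨hm, ho, ha⟩
    have hm' : IsMatchingOf V μ := by
      have := isMatchingOf_map e.symm hm
      have h1 : ∀ W, e.symm.finsetCongr (e.finsetCongr W) = W := e.finsetCongr.symm_apply_apply
      have h2 : e.symm.finsetCongr.finsetCongr (E.finsetCongr μ) = μ :=
        E.finsetCongr.symm_apply_apply μ
      rw [h1] at this
      exact h2 ▸ this
    refine ⟨hm', ?_, ?_⟩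
    · have := isOrientation_comp E.symm (μ := E.finsetCongr μ) ?_ ho
      · have h2 : E.symm.finsetCongr (E.finsetCongr μ) = μ :=
          E.finsetCongr.symm_apply_apply μ
        rw [h2] at this
        simpa using this
      · simp only [Equiv.finsetCongr_apply, Finset.mem_map, Equiv.coe_toEmbedding]
        rintro _ ⟨B, hB, rfl⟩ _ ⟨B', hB', rfl⟩
        simp only [Equiv.symm_apply_apply]
        exact (hc B (hsub hm' B hB) B' (hsub hm' B' hB')).symm
    · simpa using ha.comp E

theorem crosses_image_of_strictMonoOn (e : Equiv.Perm ℕ) (V : Finset ℕ)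
    (he : StrictMonoOn e V) {B B' : Finset ℕ} (hB : B ⊆ V) (hB' : B' ⊆ V) :
    Crosses (e.finsetCongr B) (e.finsetCongr B') ↔ Crosses B B' := by
  have hlt : ∀ x ∈ V, ∀ y ∈ V, (e x < e y ↔ x < y) := fun x hx y hy =>
    he.lt_iff_lt (Finset.mem_coe.2 hx) (Finset.mem_coe.2 hy)
  simp only [Crosses, Equiv.finsetCongr_apply, Finset.mem_map, Equiv.coe_toEmbedding,
    exists_exists_and_eq_and]
  refine exists_congr fun i => and_congr_right fun hi => exists_congr fun k =>
    and_congr_right fun hk => exists_congr fun j => and_congr_right fun hj =>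
    exists_congr fun l => and_congr_right fun hl => ?_
  simp only [gt_iff_lt, hlt _ (hB hi) _ (hB' hj), hlt _ (hB' hj) _ (hB hk),
    hlt _ (hB hk) _ (hB' hl), hlt _ (hB' hj) _ (hB hi), hlt _ (hB hk) _ (hB' hj),
    hlt _ (hB' hl) _ (hB hk)]

theorem acyclicMatchingCount_eq_of_card_eq (V V' : Finset ℕ) (h : V.card = V'.card) :
    acyclicMatchingCount V = acyclicMatchingCount V' := by
  let f := V.orderEmbOfFin rfl
  let g := V'.orderEmbOfFin h.symm
  obtain ⟨e, he⟩ := Equiv.Perm.exists_extending_pair f g f.injective g.injective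
  have hf : ∀ x ∈ V, ∃ i, f i = x := fun x hx => by
    have : x ∈ Set.range f := by rw [Finset.range_orderEmbOfFin]; exact hx
    exact this
  have hmono : StrictMonoOn e V := by
    intro x hx y hy hxy
    obtain ⟨i, rfl⟩ := hf x hx
    obtain ⟨j, rfl⟩ := hf y hy
    rw [he, he]
    exact g.strictMono (f.lt_iff_lt.1 hxy)
  have hV : e.finsetCongr V = V' := by
    refine Finset.eq_of_subset_of_card_le ?_ (by simp [h])
    intro y hy
    obtain ⟨x, hx, rfl⟩ := Finset.mem_map.1 hy
    obtain ⟨i, rfl⟩ := hf x hx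
    simp only [Equiv.coe_toEmbedding, he]
    exact Finset.orderEmbOfFin_mem _ _ _
  rw [← hV]
  exact acyclicMatchingCount_congr e V fun B hB B' hB' =>
    crosses_image_of_strictMonoOn e V hmono hB hB'

theorem countA_eq_of_perm (n : ℕ) (S T : Finset ℕ) (hS : S ⊆ Finset.range n)
    (hT : T ⊆ Finset.range n) (hSne : S.Nonempty) (hTne : T.Nonempty) (e : Equiv.Perm ℕ)
    (he : e.finsetCongr (Finset.range n \ S) = Finset.range n \ T)
    (hroot : ∀ B ⊆ Finset.range n \ S, B.card = 2 →
      (Crosses (e.finsetCongr B) T ↔ Crosses B S))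
    (hpair : ∀ B ⊆ Finset.range n \ S, ∀ B' ⊆ Finset.range n \ S, B.card = 2 → B'.card = 2 →
      ¬ Crosses B S → ¬ Crosses B' S → Disjoint B B' →
      (Crosses (e.finsetCongr B) (e.finsetCongr B') ↔ Crosses B B')) :
    countA n S = countA n T := by
  classical
  have hmem : ∀ I : Finset (Finset ℕ),
      I ∈ {I ∈ ((Finset.range n \ S).powersetCard 2).powerset | IsNoncrossingAlong S I} ↔
      e.finsetCongr.finsetCongr I ∈
        {I ∈ ((Finset.range n \ T).powersetCard 2).powerset | IsNoncrossingAlong T I} := by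
    intro I
    have hP : I ∈ ((Finset.range n \ S).powersetCard 2).powerset ↔
        e.finsetCongr.finsetCongr I ∈ ((Finset.range n \ T).powersetCard 2).powerset := by
      rw [← he]
      have hB : ∀ B, e.finsetCongr B ∈ (e.finsetCongr (Finset.range n \ S)).powersetCard 2 ↔
          B ∈ (Finset.range n \ S).powersetCard 2 := by
        simp [Finset.mem_powersetCard]
      rw [Finset.mem_powerset, Finset.mem_powerset]
      refine ⟨fun h C hC => ?_, fun h B hBI => (hB B).1 (h (Finset.mem_map_of_mem _ hBI))⟩
      obtain ⟨B, hBI, rfl⟩ := Finset.mem_map.1 hC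
      exact (hB B).2 (h hBI)
    rw [Finset.mem_filter, Finset.mem_filter, ← hP]
    refine and_congr_right fun hI => ?_
    have hI' : ∀ B ∈ I, B ⊆ Finset.range n \ S ∧ B.card = 2 := fun B hB =>
      Finset.mem_powersetCard.1 (Finset.mem_powerset.1 hI hB)
    have hroot' : (∀ B ∈ e.finsetCongr.finsetCongr I, ¬ Crosses B T) ↔
        ∀ B ∈ I, ¬ Crosses B S := by
      simp only [e.finsetCongr.finsetCongr_apply, Finset.forall_mem_map, Equiv.coe_toEmbedding]
      exact forall₂_congr fun B hB => not_congr (hroot B (hI' B hB).1 (hI' B hB).2)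
    rw [IsNoncrossingAlong, IsNoncrossingAlong, hroot']
    refine and_congr_left fun hIS => ?_
    simp only [e.finsetCongr.finsetCongr_apply, Finset.forall_mem_map, Equiv.coe_toEmbedding]
    refine forall₂_congr fun B hB => forall₂_congr fun B' hB' => ?_
    rw [e.finsetCongr.injective.ne_iff]
    refine imp_congr_right fun hn => ?_
    have hdis : Disjoint (e.finsetCongr B) (e.finsetCongr B') ↔ Disjoint B B' := by
      simp [Finset.disjoint_map]
    rw [hdis]
    exact and_congr_right fun hd => not_congr (hpair B (hI' B hB).1 B' (hI' B' hB').1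
      (hI' B hB).2 (hI' B' hB').2 (hIS B hB) (hIS B' hB') hd).symm
  have : (countA n S : ℤ) = countA n T := by
    rw [countA_eq_sum n S hS hSne, countA_eq_sum n T hT hTne]
    refine Finset.sum_equiv e.finsetCongr.finsetCongr (fun I => by convert hmem I) fun I _ => ?_
    have h1 : (e.finsetCongr.finsetCongr I).card = I.card := by simp
    have h2 : (Finset.range n \ T) \ (e.finsetCongr.finsetCongr I).sup id =
        e.finsetCongr ((Finset.range n \ S) \ I.sup id) := by
      rw [← he]
      ext x
      simp [Finset.mem_sup]
    rw [h1, h2, acyclicMatchingCount_eq_of_card_eq _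
      (e.finsetCongr ((Finset.range n \ S) \ I.sup id)) (by simp)]
  exact_mod_cast this

/-- The clockwise distance from `a` to `x` on a cycle of length `n`. -/
def clockwiseDist (n a x : ℕ) : ℕ := if a ≤ x then x - a else x + n - a

/-- The point at clockwise distance `d` from `a` on a cycle of length `n`. -/
def clockwiseShift (n a d : ℕ) : ℕ := if a + d < n then a + d else a + d - n

/-- The points `a i` enumerate `S`, and the arc of length `G i` starting at `a i` is the arc of
the cycle `{0, ..., n-1}` from `a i` to the next point of `S`. -/
structure IsArcSystem (n : ℕ) (S : Finset ℕ) {ι : Type*} (a G : ι → ℕ) : Prop where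
  lt : ∀ s ∈ S, s < n
  mem : ∀ i, a i ∈ S
  injective : Function.Injective a
  le : ∀ i, G i ≤ n
  far : ∀ i, ∀ s ∈ S, s = a i ∨ G i ≤ clockwiseDist n (a i) s
  cover : ∀ x < n, x ∉ S → ∃ i, clockwiseDist n (a i) x < G i

/-- The points `x`, `s`, `y`, `t` are distinct and occur in this cyclic order. -/
def InCyclicOrder (x s y t : ℕ) : Prop :=
  (x < s ∧ s < y ∧ y < t) ∨ (s < y ∧ y < t ∧ t < x) ∨ (y < t ∧ t < x ∧ x < s) ∨
    (t < x ∧ x < s ∧ s < y)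

theorem InCyclicOrder.rotate {x s y t : ℕ} (h : InCyclicOrder x s y t) :
    InCyclicOrder s y t x := by
  unfold InCyclicOrder at *
  tauto

/-- The chords `{x, y}` and `{s, t}` have interlacing endpoints. -/
def Interlace (x y s t : ℕ) : Prop := InCyclicOrder x s y t ∨ InCyclicOrder x t y s

theorem crosses_pair_iff (x y : ℕ) (S : Finset ℕ) :
    Crosses {x, y} S ↔ ∃ s ∈ S, ∃ t ∈ S, Interlace x y s t := by
  constructor
  · rintro ⟨i, hi, k, hk, j, hj, l, hl, h⟩
    simp only [Finset.mem_insert, Finset.mem_singleton] at hi hk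
    refine ⟨j, hj, l, hl, ?_⟩
    rcases hi with rfl | rfl <;> rcases hk with rfl | rfl
    · omega
    · rcases h with h | ⟨h1, h2, h3⟩
      · exact .inl (.inl h)
      · exact .inr (.inr (.inl ⟨h3, h2, h1⟩))
    · rcases h with h | ⟨h1, h2, h3⟩
      · exact .inr (.inr (.inr (.inl h)))
      · exact .inl (.inr (.inr (.inr ⟨h3, h2, h1⟩)))
    · omega
  · rintro ⟨s, hs, t, ht, (h | h | h | h) | (h | h | h | h)⟩
    · exact ⟨x, by simp, y, by simp, s, hs, t, ht, by omega⟩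
    · exact ⟨x, by simp, y, by simp, t, ht, s, hs, by omega⟩
    · exact ⟨y, by simp, x, by simp, t, ht, s, hs, by omega⟩
    · exact ⟨y, by simp, x, by simp, s, hs, t, ht, by omega⟩
    · exact ⟨x, by simp, y, by simp, t, ht, s, hs, by omega⟩
    · exact ⟨x, by simp, y, by simp, s, hs, t, ht, by omega⟩
    · exact ⟨y, by simp, x, by simp, s, hs, t, ht, by omega⟩
    · exact ⟨y, by simp, x, by simp, t, ht, s, hs, by omega⟩

theorem not_inCyclicOrder_self {x y s : ℕ} : ¬ InCyclicOrder x s y s := by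
  unfold InCyclicOrder
  omega

theorem crosses_pair_pair_iff (x y z w : ℕ) : Crosses {x, y} {z, w} ↔ Interlace x y z w := by
  rw [crosses_pair_iff]
  simp only [Finset.mem_insert, Finset.mem_singleton, exists_eq_or_imp, exists_eq_left]
  simp [Interlace, not_inCyclicOrder_self, or_comm]

theorem clockwiseDist_cases {n a x : ℕ} (hx : x < n) (ha : a < n) :
    a ≤ x ∧ a + clockwiseDist n a x = x ∨ x < a ∧ a + clockwiseDist n a x = x + n := by
  unfold clockwiseDist
  split_ifs <;> omega

theorem clockwiseShift_cases {n a d : ℕ} :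
    a + d < n ∧ clockwiseShift n a d = a + d ∨
      n ≤ a + d ∧ clockwiseShift n a d + n = a + d := by
  unfold clockwiseShift
  split_ifs <;> omega

theorem inCyclicOrder_clockwiseDist_of_lt {n a x s y t : ℕ} (hxs : x < s) (hsy : s < y)
    (hyt : y < t) (ht : t < n) (ha : a < n) :
    InCyclicOrder (clockwiseDist n a x) (clockwiseDist n a s) (clockwiseDist n a y)
      (clockwiseDist n a t) := by
  have h1 := clockwiseDist_cases (show x < n by omega) ha
  have h2 := clockwiseDist_cases (show s < n by omega) ha
  have h3 := clockwiseDist_cases (show y < n by omega) ha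
  have h4 := clockwiseDist_cases ht ha
  unfold InCyclicOrder
  by_cases c1 : a ≤ x
  · left; omega
  by_cases c2 : a ≤ s
  · right; left; omega
  by_cases c3 : a ≤ y
  · right; right; left; omega
  by_cases c4 : a ≤ t
  · right; right; right; omega
  · left; omega

theorem InCyclicOrder.clockwiseDist {n a x s y t : ℕ} (h : InCyclicOrder x s y t) (hx : x < n)
    (hs : s < n) (hy : y < n) (ht : t < n) (ha : a < n) :
    InCyclicOrder (clockwiseDist n a x) (clockwiseDist n a s) (clockwiseDist n a y)
      (clockwiseDist n a t) := by
  rcases h with h | h | h | h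
  · exact inCyclicOrder_clockwiseDist_of_lt h.1 h.2.1 h.2.2 ht ha
  · exact (inCyclicOrder_clockwiseDist_of_lt h.1 h.2.1 h.2.2 hx ha).rotate.rotate.rotate
  · exact (inCyclicOrder_clockwiseDist_of_lt h.1 h.2.1 h.2.2 hs ha).rotate.rotate
  · exact (inCyclicOrder_clockwiseDist_of_lt h.1 h.2.1 h.2.2 hy ha).rotate

theorem clockwiseDist_lt {n a x : ℕ} (hx : x < n) (ha : a < n) : clockwiseDist n a x < n := by
  have := clockwiseDist_cases hx ha
  omega

theorem exists_clockwiseDist_clockwiseDist {n a : ℕ} (ha : a < n) :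
    ∃ a' < n, ∀ x < n, clockwiseDist n a' (clockwiseDist n a x) = x := by
  refine ⟨if a = 0 then 0 else n - a, by split_ifs <;> omega, fun x hx => ?_⟩
  have h1 := clockwiseDist_cases hx ha
  have h2 := clockwiseDist_cases (clockwiseDist_lt hx ha)
    (show (if a = 0 then 0 else n - a) < n by split_ifs <;> omega)
  split_ifs at * <;> omega

theorem inCyclicOrder_clockwiseDist_iff {n a x s y t : ℕ} (hx : x < n)
    (hs : s < n) (hy : y < n) (ht : t < n) (ha : a < n) :
    InCyclicOrder (clockwiseDist n a x) (clockwiseDist n a s) (clockwiseDist n a y)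
      (clockwiseDist n a t) ↔ InCyclicOrder x s y t := by
  refine ⟨fun h => ?_, fun h => h.clockwiseDist hx hs hy ht ha⟩
  obtain ⟨a', ha', h'⟩ := exists_clockwiseDist_clockwiseDist ha
  have := h.clockwiseDist (clockwiseDist_lt hx ha) (clockwiseDist_lt hs ha)
    (clockwiseDist_lt hy ha) (clockwiseDist_lt ht ha) ha'
  rwa [h' x hx, h' s hs, h' y hy, h' t ht] at this

theorem interlace_clockwiseDist_iff {n a x y s t : ℕ} (hx : x < n)
    (hy : y < n) (hs : s < n) (ht : t < n) (ha : a < n) :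
    Interlace (clockwiseDist n a x) (clockwiseDist n a y) (clockwiseDist n a s)
      (clockwiseDist n a t) ↔ Interlace x y s t :=
  or_congr (inCyclicOrder_clockwiseDist_iff hx hs hy ht ha)
    (inCyclicOrder_clockwiseDist_iff hx ht hy hs ha)

theorem clockwiseShift_lt {n a d : ℕ} (ha : a < n) (hd : d < n) : clockwiseShift n a d < n := by
  have := clockwiseShift_cases (n := n) (a := a) (d := d)
  omega

theorem clockwiseDist_clockwiseShift {n a d : ℕ} (ha : a < n) (hd : d < n) :
    clockwiseDist n a (clockwiseShift n a d) = d := by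
  have h1 := clockwiseShift_cases (n := n) (a := a) (d := d)
  have h2 := clockwiseDist_cases (clockwiseShift_lt ha hd) ha
  omega

theorem clockwiseDist_clockwiseShift_of_lt {n a b d : ℕ} (ha : a < n) (hb : b < n)
    (hd : d < clockwiseDist n b a) :
    clockwiseDist n a (clockwiseShift n b d) = clockwiseDist n a b + d := by
  have h0 := clockwiseDist_cases ha hb
  have h1 := clockwiseShift_cases (n := n) (a := b) (d := d)
  have h2 := clockwiseDist_cases (clockwiseShift_lt hb (hd.trans (clockwiseDist_lt ha hb))) ha
  have h3 := clockwiseDist_cases hb ha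
  omega

namespace IsArcSystem

variable {n : ℕ} {S : Finset ℕ} {ι : Type*} {a G : ι → ℕ}

theorem shift_mem (h : IsArcSystem n S a G) {i : ι} {d : ℕ} (h0 : 0 < d) (hd : d < G i) :
    clockwiseShift n (a i) d ∈ Finset.range n \ S := by
  have ha := h.lt _ (h.mem i)
  have hle := h.le i
  have hs := clockwiseShift_cases (n := n) (a := a i) (d := d)
  rw [Finset.mem_sdiff, Finset.mem_range]
  refine ⟨by omega, fun hm => ?_⟩
  have hx := h.lt _ hm
  have := clockwiseDist_cases hx ha
  rcases h.far i _ hm with h | h <;> omega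

theorem far_of_ne (h : IsArcSystem n S a G) {i j : ι} (hij : i ≠ j) :
    G i ≤ clockwiseDist n (a i) (a j) :=
  (h.far i _ (h.mem j)).resolve_left fun e => hij (h.injective e).symm

theorem shift_injective (h : IsArcSystem n S a G) {i j : ι} {d e : ℕ} (hd : d < G i)
    (he : e < G j) (heq : clockwiseShift n (a i) d = clockwiseShift n (a j) e) :
    i = j ∧ d = e := by
  have hai := h.lt _ (h.mem i)
  have haj := h.lt _ (h.mem j)
  have hli := h.le i
  have hlj := h.le j
  have hsi := clockwiseShift_cases (n := n) (a := a i) (d := d)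
  have hsj := clockwiseShift_cases (n := n) (a := a j) (d := e)
  by_cases hij : i = j
  · subst hij
    exact ⟨rfl, by omega⟩
  · have h1 := h.far_of_ne hij
    have h2 := h.far_of_ne (Ne.symm hij)
    have h3 := clockwiseDist_cases haj hai
    have h4 := clockwiseDist_cases hai haj
    omega

theorem exists_shift_eq (h : IsArcSystem n S a G) {x : ℕ} (hx : x ∈ Finset.range n \ S) :
    ∃ i d, 0 < d ∧ d < G i ∧ clockwiseShift n (a i) d = x := by
  rw [Finset.mem_sdiff, Finset.mem_range] at hx
  obtain ⟨i, hi⟩ := h.cover x hx.1 hx.2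
  have ha := h.lt _ (h.mem i)
  have hne : x ≠ a i := fun e => hx.2 (e ▸ h.mem i)
  have h3 := clockwiseDist_cases hx.1 ha
  have hs := clockwiseShift_cases (n := n) (a := a i) (d := clockwiseDist n (a i) x)
  exact ⟨i, clockwiseDist n (a i) x, by omega, hi, by omega⟩

theorem crosses_iff (h : IsArcSystem n S a G) {i j : ι} {d e : ℕ} (hd0 : 0 < d)
    (hd : d < G i) (he0 : 0 < e) (he : e < G j) :
    Crosses {clockwiseShift n (a i) d, clockwiseShift n (a j) e} S ↔ i ≠ j := by
  have hai := h.lt _ (h.mem i)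
  have haj := h.lt _ (h.mem j)
  have hx := clockwiseShift_lt hai (hd.trans_le (h.le i))
  have hy := clockwiseShift_lt haj (he.trans_le (h.le j))
  have hself : clockwiseDist n (a i) (a i) = 0 := by simp [clockwiseDist]
  rw [_root_.crosses_pair_iff]
  constructor
  · rintro ⟨s, hs, t, ht, hI⟩ rfl
    rw [← interlace_clockwiseDist_iff hx hy (h.lt s hs) (h.lt t ht) hai,
      clockwiseDist_clockwiseShift hai (hd.trans_le (h.le i)),
      clockwiseDist_clockwiseShift hai (he.trans_le (h.le i))] at hI
    have key : ∀ s ∈ S, clockwiseDist n (a i) s = 0 ∨ G i ≤ clockwiseDist n (a i) s :=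
      fun s hs => (h.far i s hs).imp_left fun h' => by rw [h', hself]
    have h1 := key s hs
    have h2 := key t ht
    rcases hI with (h | h | h | h) | (h | h | h | h) <;> omega
  · intro hij
    refine ⟨a i, h.mem i, a j, h.mem j, ?_⟩
    have h1 := h.far_of_ne hij
    rw [← interlace_clockwiseDist_iff hx hy hai haj hai,
      clockwiseDist_clockwiseShift hai (hd.trans_le (h.le i)),
      clockwiseDist_clockwiseShift_of_lt hai haj (he.trans_le (h.far_of_ne (Ne.symm hij))),
      hself]
    right; right; right; right; omega

theorem crosses_pair_iff (h : IsArcSystem n S a G) {i j : ι} {d d' e e' : ℕ}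
    (hd : d < G i) (hd' : d' < G i) (he : e < G j) (he' : e' < G j) :
    Crosses {clockwiseShift n (a i) d, clockwiseShift n (a i) d'}
      {clockwiseShift n (a j) e, clockwiseShift n (a j) e'} ↔ i = j ∧ Interlace d d' e e' := by
  have hai := h.lt _ (h.mem i)
  have haj := h.lt _ (h.mem j)
  have hdn := hd.trans_le (h.le i)
  have hdn' := hd'.trans_le (h.le i)
  have hen := he.trans_le (h.le j)
  have hen' := he'.trans_le (h.le j)
  rw [crosses_pair_pair_iff, ← interlace_clockwiseDist_iff (clockwiseShift_lt hai hdn)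
    (clockwiseShift_lt hai hdn') (clockwiseShift_lt haj hen) (clockwiseShift_lt haj hen') hai,
    clockwiseDist_clockwiseShift hai hdn, clockwiseDist_clockwiseShift hai hdn']
  by_cases hij : i = j
  · subst hij
    rw [clockwiseDist_clockwiseShift hai hen, clockwiseDist_clockwiseShift hai hen']
    simp
  · have h1 := h.far_of_ne hij
    have h2 := h.far_of_ne (Ne.symm hij)
    rw [clockwiseDist_clockwiseShift_of_lt hai haj (he.trans_le h2),
      clockwiseDist_clockwiseShift_of_lt hai haj (he'.trans_le h2)]
    simp only [hij, false_and, iff_false]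
    rintro ((h | h | h | h) | (h | h | h | h)) <;> omega

end IsArcSystem

theorem countA_eq_of_isArcSystem {n : ℕ} {S T : Finset ℕ} {ι : Type*} [Nonempty ι]
    {a b G : ι → ℕ} (hS : IsArcSystem n S a G) (hT : IsArcSystem n T b G) :
    countA n S = countA n T := by
  let K := {p : ι × ℕ // 0 < p.2 ∧ p.2 < G p.1}
  let f : K → ℕ := fun p => clockwiseShift n (a p.1.1) p.1.2
  let g : K → ℕ := fun p => clockwiseShift n (b p.1.1) p.1.2
  have hf : Function.Injective f := fun p q h => by
    obtain ⟨h1, h2⟩ := hS.shift_injective p.2.2 q.2.2 h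
    exact Subtype.ext (Prod.ext h1 h2)
  have hg : Function.Injective g := fun p q h => by
    obtain ⟨h1, h2⟩ := hT.shift_injective p.2.2 q.2.2 h
    exact Subtype.ext (Prod.ext h1 h2)
  have hfm : ∀ p, f p ∈ Finset.range n \ S := fun p => hS.shift_mem p.2.1 p.2.2
  have hgm : ∀ p, g p ∈ Finset.range n \ T := fun p => hT.shift_mem p.2.1 p.2.2
  have hfs : ∀ x ∈ Finset.range n \ S, ∃ p, f p = x := fun x hx => by
    obtain ⟨i, d, h0, hd, hx⟩ := hS.exists_shift_eq hx
    exact ⟨⟨(i, d), h0, hd⟩, hx⟩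
  have hgs : ∀ x ∈ Finset.range n \ T, ∃ p, g p = x := fun x hx => by
    obtain ⟨i, d, h0, hd, hx⟩ := hT.exists_shift_eq hx
    exact ⟨⟨(i, d), h0, hd⟩, hx⟩
  have : Finite K := Finite.of_injective
    (fun p => (⟨f p, hfm p⟩ : {x // x ∈ Finset.range n \ S}))
    fun p q h => hf (congrArg Subtype.val h)
  obtain ⟨e, he⟩ := Equiv.Perm.exists_extending_pair f g hf hg
  have hpairs : ∀ B ⊆ Finset.range n \ S, B.card = 2 → ∃ p q, B = {f p, f q} ∧
      e.finsetCongr B = {g p, g q} := by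
    intro B hB h2
    obtain ⟨x, y, -, rfl⟩ := Finset.card_eq_two.1 h2
    obtain ⟨p, rfl⟩ := hfs x (hB (by simp))
    obtain ⟨q, rfl⟩ := hfs y (hB (by simp))
    exact ⟨p, q, rfl, by simp [he]⟩
  have i₀ : ι := Classical.arbitrary ι
  refine countA_eq_of_perm n S T (fun s hs => Finset.mem_range.2 (hS.lt s hs))
    (fun s hs => Finset.mem_range.2 (hT.lt s hs)) ⟨_, hS.mem i₀⟩ ⟨_, hT.mem i₀⟩ e ?_ ?_ ?_
  · ext x
    simp only [Equiv.finsetCongr_apply, Finset.mem_map, Equiv.coe_toEmbedding]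
    constructor
    · rintro ⟨y, hy, rfl⟩
      obtain ⟨p, rfl⟩ := hfs y hy
      rw [he]
      exact hgm p
    · intro hx
      obtain ⟨p, rfl⟩ := hgs x hx
      exact ⟨f p, hfm p, he p⟩
  · intro B hB h2
    obtain ⟨p, q, rfl, h⟩ := hpairs B hB h2
    rw [h]
    exact (hT.crosses_iff p.2.1 p.2.2 q.2.1 q.2.2).trans
      (hS.crosses_iff p.2.1 p.2.2 q.2.1 q.2.2).symm
  · intro B hB B' hB' h2 h2' hc hc' _
    obtain ⟨p, q, rfl, h⟩ := hpairs B hB h2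
    obtain ⟨p', q', rfl, h'⟩ := hpairs B' hB' h2'
    have hpq : p.1.1 = q.1.1 := by
      by_contra hn
      exact hc ((hS.crosses_iff p.2.1 p.2.2 q.2.1 q.2.2).2 hn)
    have hpq' : p'.1.1 = q'.1.1 := by
      by_contra hn
      exact hc' ((hS.crosses_iff p'.2.1 p'.2.2 q'.2.1 q'.2.2).2 hn)
    rw [h, h']
    obtain ⟨⟨i, d⟩, hd0, hd⟩ := p
    obtain ⟨⟨_, d'⟩, hd0', hd'⟩ := q
    obtain ⟨⟨j, c⟩, hc0, hc1⟩ := p'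
    obtain ⟨⟨_, c'⟩, hc0', hc1'⟩ := q'
    dsimp only at hpq hpq'
    subst hpq hpq'
    exact (hT.crosses_pair_iff hd hd' hc1 hc1').trans (hS.crosses_pair_iff hd hd' hc1 hc1').symm

theorem exists_perm_of_map_univ_eq {ι α : Type*} [Fintype ι] {f g : ι → α}
    (h : Finset.univ.val.map f = Finset.univ.val.map g) :
    ∃ σ : Equiv.Perm ι, ∀ i, g (σ i) = f i := by
  classical
  have hc : ∀ c, Nonempty ({i // f i = c} ≃ {i // g i = c}) := by
    intro c
    rw [← Fintype.card_eq, Fintype.card_subtype, Fintype.card_subtype]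
    have := congrArg (Multiset.count c) h
    simp only [Multiset.count_map] at this
    simp only [Finset.card_def, Finset.filter_val, eq_comm (b := c)]
    exact this
  let e := fun c => (hc c).some
  exact ⟨Equiv.ofFiberEquiv e, Equiv.ofFiberEquiv_map e⟩

theorem sub_emod_eq_clockwiseDist {n x y : ℕ} (hx : x < n) (hy : y < n) :
    ((y : ℤ) - x) % n = clockwiseDist n x y := by
  rcases clockwiseDist_cases hy hx with h | h
  · rw [Int.emod_eq_of_lt (by omega) (by omega)]
    omega
  · rw [← Int.add_emod_right, Int.emod_eq_of_lt (by omega) (by omega)]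
    omega

theorem cyclicGaps_eq_map {n m : ℕ} [NeZero m] {S : Finset ℕ} (hS : S ⊆ Finset.range n)
    (hm : S.card = m) :
    cyclicGaps n S = Finset.univ.val.map fun i : Fin m =>
      (clockwiseDist n (S.orderEmbOfFin hm i) (S.orderEmbOfFin hm (i + 1)) : ℤ) := by
  rw [Fin.univ_val_map, cyclicGaps]
  congr 1
  apply List.ext_getElem
  · simp [hm]
  · intro i h1 h2
    have hi : i < m := by simpa using h2
    have hlt : ∀ j, S.orderEmbOfFin hm j < n := fun j =>
      Finset.mem_range.1 (hS (Finset.orderEmbOfFin_mem _ _ _))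
    rw [List.getElem_ofFn, ← sub_emod_eq_clockwiseDist (hlt _) (hlt _), List.getElem_zipWith,
      List.getElem_rotate, Finset.orderEmbOfFin_apply, Finset.orderEmbOfFin_apply]
    simp [Fin.val_add, hm]

theorem isArcSystem_orderEmbOfFin {n m : ℕ} [NeZero m] {S : Finset ℕ}
    (hS : S ⊆ Finset.range n) (hm : S.card = m) (G : Fin m → ℕ)
    (hG : ∀ i, G i = if clockwiseDist n (S.orderEmbOfFin hm i) (S.orderEmbOfFin hm (i + 1)) = 0
      then n else clockwiseDist n (S.orderEmbOfFin hm i) (S.orderEmbOfFin hm (i + 1))) :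
    IsArcSystem n S (S.orderEmbOfFin hm) G := by
  have hlt : ∀ j, S.orderEmbOfFin hm j < n := fun j =>
    Finset.mem_range.1 (hS (Finset.orderEmbOfFin_mem _ _ _))
  refine ⟨fun s hs => Finset.mem_range.1 (hS hs), Finset.orderEmbOfFin_mem _ _,
    (S.orderEmbOfFin hm).injective, fun i => ?_, fun i s hs => ?_, fun x hx hxS => ?_⟩
  · have h0 := hlt (i + 1)
    have h0' := hlt i
    have := clockwiseDist_cases h0 h0'
    rw [hG]
    split_ifs <;> omega
  · have : s ∈ Set.range (S.orderEmbOfFin hm) := by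
      rw [Finset.range_orderEmbOfFin]; exact hs
    obtain ⟨j, rfl⟩ := this
    have hmono : ∀ p q : Fin m, p.1 < q.1 → S.orderEmbOfFin hm p < S.orderEmbOfFin hm q :=
      fun p q h => (S.orderEmbOfFin hm).strictMono h
    have hmono' : ∀ p q : Fin m, p.1 ≤ q.1 → S.orderEmbOfFin hm p ≤ S.orderEmbOfFin hm q :=
      fun p q h => (S.orderEmbOfFin hm).monotone h
    have h0 := hlt (i + 1)
    have h0' := hlt i
    have h1 := clockwiseDist_cases h0 h0'
    have h2 := clockwiseDist_cases (hlt j) h0'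
    rcases lt_trichotomy i.1 j.1 with hij | hij | hij
    · right
      have hi1 : (i + 1).1 = i.1 + 1 := Fin.val_add_one_of_lt' (by omega)
      have h3 := hmono i j hij
      have h4 := hmono i (i + 1) (by rw [hi1]; omega)
      have h5 := hmono' (i + 1) j (by rw [hi1]; omega)
      rw [hG]
      split_ifs <;> omega
    · left
      rw [Fin.ext hij]
    · right
      have h3 := hmono j i hij
      rw [hG]
      by_cases hi : i.1 + 1 < m
      · have hi1 : (i + 1).1 = i.1 + 1 := Fin.val_add_one_of_lt' hi
        have h4 := hmono i (i + 1) (by rw [hi1]; omega)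
        split_ifs <;> omega
      · have hi1 : (i + 1).1 = 0 := by
          have : i.1 + 1 = m := by omega
          rw [Fin.val_add, Fin.val_one', Nat.add_mod_mod, this, Nat.mod_self]
        have h5 := hmono (i + 1) i (by rw [hi1]; omega)
        have h6 := hmono' (i + 1) j (by rw [hi1]; omega)
        split_ifs <;> omega
  · obtain ⟨i, hi⟩ := Finite.exists_min fun i => clockwiseDist n (S.orderEmbOfFin hm i) x
    refine ⟨i, ?_⟩
    have h0 := hi (i + 1)
    have h1 := clockwiseDist_cases (hlt (i + 1)) (hlt i)
    have h2 := clockwiseDist_cases hx (hlt i)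
    have h3 := clockwiseDist_cases hx (hlt (i + 1))
    rw [hG]
    split_ifs <;> omega

theorem IsArcSystem.comp_equiv {n : ℕ} {S : Finset ℕ} {ι κ : Type*} {a G : ι → ℕ}
    (h : IsArcSystem n S a G) (σ : κ ≃ ι) : IsArcSystem n S (a ∘ σ) (G ∘ σ) where
  lt := h.lt
  mem i := h.mem _
  injective := h.injective.comp σ.injective
  le i := h.le _
  far i := h.far _
  cover x hx hxS := by
    obtain ⟨i, hi⟩ := h.cover x hx hxS
    exact ⟨σ.symm i, by simpa using hi⟩

/-- `A_{k+1}(S)` depends only on the multiset of cyclic gaps of `S`. -/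
theorem countA_eq_of_cyclicGaps_eq (n k : ℕ) (S T : Finset ℕ)
    (hS : S ⊆ Finset.range n) (hT : T ⊆ Finset.range n)
    (hcard : S.card = T.card) (hn : n = S.card + 2 * k)
    (hgaps : cyclicGaps n S = cyclicGaps n T) :
    countA n S = countA n T := by
  rcases Nat.eq_zero_or_pos S.card with h0 | hpos
  · rw [Finset.card_eq_zero.1 h0, Finset.card_eq_zero.1 (hcard.symm.trans h0)]
  have : NeZero S.card := ⟨hpos.ne'⟩
  rw [cyclicGaps_eq_map hS rfl, cyclicGaps_eq_map hT hcard.symm] at hgaps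
  obtain ⟨σ, hσ⟩ := exists_perm_of_map_univ_eq hgaps
  have hT' := (isArcSystem_orderEmbOfFin hT hcard.symm _ fun _ => rfl).comp_equiv σ
  refine countA_eq_of_isArcSystem (isArcSystem_orderEmbOfFin hS rfl _ fun i => ?_) hT'
  have := hσ i
  norm_cast at this
  simp only [Function.comp_apply, this]
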